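/- arXiv:2511.17700 — 2 statements merged into one kernel-verified Lean document; each statement's English description precedes it below -/
import Mathlib

section
/- Let k be a field, R a commutative k-algebra and I ⊆ R an ideal. Regard the extended Rees algebra R̃_I as a module over the polynomial ring k[t] via the k-algebra map k[t] → R̃_I sending t to t. Then R̃_I is a flat k[t]-module. This is the algebraic statement that the deformation to the normal cone family D_{Y/X} → ℂ is flat over the affine line. -/
set_option synthInstance.maxHeartbeats 400000
set_option maxHeartbeats 800000

open LaurentPolynomial

/-- The extended Rees algebra of an ideal `I ⊆ R`: the `R`-subalgebra of the Laurent
polynomial ring `R[T;T⁻¹]` generated by `t` together with all `a·t⁻¹` for `a ∈ I`. -/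
noncomputable def extendedReesAlgebra (R : Type*) [CommRing R] (I : Ideal R) :
    Subalgebra R (LaurentPolynomial R) :=
  Algebra.adjoin R ({LaurentPolynomial.T 1} ∪
    {x | ∃ a ∈ I, x = LaurentPolynomial.C a * LaurentPolynomial.T (-1)})

/-- The variable `t` belongs to the extended Rees algebra. -/
theorem T_mem_extendedReesAlgebra {R : Type*} [CommRing R] (I : Ideal R) :
    (LaurentPolynomial.T 1 : LaurentPolynomial R) ∈ extendedReesAlgebra R I :=
  Algebra.subset_adjoin (Set.mem_union_left _ rfl)

/-- The image of a nonzero polynomial over a field `k` in `R[T;T⁻¹]` is a non-zero-divisor. -/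
theorem eq_zero_of_toLaurent_map_mul_eq_zero {k R : Type*} [Field k] [CommRing R] [Algebra k R]
    {p : Polynomial k} (hp : p ≠ 0) {f : LaurentPolynomial R}
    (h : (p.map (algebraMap k R)).toLaurent * f = 0) : f = 0 := by
  obtain ⟨n, g, hg⟩ := LaurentPolynomial.exists_T_pow f
  have hpg : p.map (algebraMap k R) * g = 0 := by
    apply Polynomial.toLaurent_injective
    rw [map_mul, hg, ← mul_assoc, h, zero_mul, map_zero]
  have hmonic := (Polynomial.monic_mul_leadingCoeff_inv hp).map (algebraMap k R)
  have hg0 : g = 0 := by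
    apply hmonic.isRegular.left
    dsimp only
    rw [Polynomial.map_mul, mul_right_comm, hpg, zero_mul, mul_zero]
  rw [hg0, map_zero] at hg
  exact (LaurentPolynomial.isUnit_T n).mul_left_eq_zero.mp hg.symm

/-- The structure map `k[t] → R̃_I` followed by the inclusion into `R[T;T⁻¹]` is the obvious map
`k[t] → R[t] → R[T;T⁻¹]`. -/
theorem extendedReesAlgebra_coe_eval₂ {k R : Type*} [Field k] [CommRing R] [Algebra k R]
    (I : Ideal R) (p : Polynomial k) :
    ((p.eval₂ ((algebraMap R (extendedReesAlgebra R I)).comp (algebraMap k R))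
        (⟨LaurentPolynomial.T 1, T_mem_extendedReesAlgebra I⟩ : extendedReesAlgebra R I) :
      extendedReesAlgebra R I) : LaurentPolynomial R) = (p.map (algebraMap k R)).toLaurent := by
  induction p using Polynomial.induction_on' with
  | add p q hp hq =>
    rw [Polynomial.eval₂_add, Subalgebra.coe_add, hp, hq, Polynomial.map_add, map_add]
  | monomial n a =>
    rw [Polynomial.eval₂_monomial, Polynomial.map_monomial, Polynomial.toLaurent_C_mul_T,
      Subalgebra.coe_mul, Subalgebra.coe_pow, LaurentPolynomial.T_pow, mul_one]
    rfl

/-- Regarding the extended Rees algebra `R̃_I` of an ideal `I` in a commutative `k`-algebra `R`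
as a `k[t]`-module via the `k`-algebra map `k[t] → R̃_I` sending `t` to `t`, it is flat.
This is the algebraic statement that the deformation to the normal cone is flat over the
affine line. -/
theorem extendedReesAlgebra_flat_over_polynomial {k : Type*} {R : Type*}
    [Field k] [CommRing R] [Algebra k R] (I : Ideal R) :
    letI : Algebra (Polynomial k) (extendedReesAlgebra R I) :=
      (Polynomial.eval₂RingHom
        ((algebraMap R (extendedReesAlgebra R I)).comp (algebraMap k R))
        (⟨LaurentPolynomial.T 1, T_mem_extendedReesAlgebra I⟩ : extendedReesAlgebra R I)).toAlgebra
    Module.Flat (Polynomial k) (extendedReesAlgebra R I) := by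
  let : Algebra (Polynomial k) (extendedReesAlgebra R I) :=
    (Polynomial.eval₂RingHom
      ((algebraMap R (extendedReesAlgebra R I)).comp (algebraMap k R))
      (⟨LaurentPolynomial.T 1, T_mem_extendedReesAlgebra I⟩ : extendedReesAlgebra R I)).toAlgebra
  have : Module.IsTorsionFree (Polynomial k) (extendedReesAlgebra R I) := by
    refine ⟨fun p hp => IsSMulRegular.of_right_eq_zero_of_smul fun x hx => ?_⟩
    rw [Algebra.smul_def] at hx
    apply Subtype.ext
    apply eq_zero_of_toLaurent_map_mul_eq_zero hp.ne_zero
    rw [← extendedReesAlgebra_coe_eval₂ I p]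
    exact congrArg Subtype.val hx
  infer_instance
end

section
/- Let R be a commutative ring, B : R × R → R a biderivation (additive in each argument and satisfying the Leibniz rule B(ab,c) = a·B(b,c) + b·B(a,c) and B(a,bc) = b·B(a,c) + c·B(a,b) for all a,b,c ∈ R), and J ⊆ R an ideal with B(J,J) ⊆ J. Then for all integers m, n ≥ 1 one has B(Jᵐ, Jⁿ) ⊆ J^{m+n−1}, i.e., B(a,b) ∈ J^{m+n−1} whenever a ∈ Jᵐ and b ∈ Jⁿ. (This is the well-definedness lemma underlying the Poisson bracket on the deformation to the normal cone in Proposition 4.1.) -/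
/-- An additive map satisfying the Leibniz rule and sending `J` into `J ^ k` sends `J ^ (m + 1)`
into `J ^ (m + k)`. -/
theorem leibniz_map_pow_succ_mem {R : Type*} [CommRing R] (D : R → R)
    (hadd : ∀ a b : R, D (a + b) = D a + D b)
    (hLeib : ∀ a b : R, D (a * b) = a * D b + b * D a)
    (J : Ideal R) (k : ℕ) (hJ : ∀ a ∈ J, D a ∈ J ^ k) (m : ℕ) :
    ∀ a ∈ J ^ (m + 1), D a ∈ J ^ (m + k) := by
  induction m with
  | zero => simpa using hJ
  | succ m ih =>
    intro a ha
    rw [pow_succ] at ha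
    refine Submodule.mul_induction_on ha (fun x hx y hy => ?_) (fun x y hx hy => ?_)
    · rw [hLeib]
      refine add_mem ?_ ?_
      · rw [pow_add]
        exact Ideal.mul_mem_mul hx (hJ y hy)
      · rw [add_right_comm, pow_succ']
        exact Ideal.mul_mem_mul hy (ih x hx)
    · rw [hadd]
      exact add_mem hx hy

/-- Let `B : R × R → R` be a biderivation (additive and Leibniz in each argument) on a
commutative ring `R`, and `J ⊆ R` an ideal with `B(J,J) ⊆ J`.  Then `B(Jᵐ, Jⁿ) ⊆ J^{m+n-1}`
for all `m, n ≥ 1`. -/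
theorem biderivation_pow_mem {R : Type*} [CommRing R] (B : R → R → R)
    (hadd₁ : ∀ a b c : R, B (a + b) c = B a c + B b c)
    (hadd₂ : ∀ a b c : R, B a (b + c) = B a b + B a c)
    (hLeib₁ : ∀ a b c : R, B (a * b) c = a * B b c + b * B a c)
    (hLeib₂ : ∀ a b c : R, B a (b * c) = b * B a c + c * B a b)
    (J : Ideal R) (hJ : ∀ a ∈ J, ∀ b ∈ J, B a b ∈ J) :
    ∀ m n : ℕ, 1 ≤ m → 1 ≤ n → ∀ a ∈ J ^ m, ∀ b ∈ J ^ n, B a b ∈ J ^ (m + n - 1) := by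
  intro m n hm hn a ha b hb
  obtain ⟨m, rfl⟩ := Nat.exists_eq_add_of_le' hm
  obtain ⟨n, rfl⟩ := Nat.exists_eq_add_of_le' hn
  have hJb : ∀ x ∈ J, B x b ∈ J ^ (n + 1) := fun x hx =>
    leibniz_map_pow_succ_mem (B x) (hadd₂ x) (hLeib₂ x) J 1
      (fun y hy => by simpa using hJ x hx y hy) n b hb
  have h := leibniz_map_pow_succ_mem (fun x => B x b) (fun x y => hadd₁ x y b)
    (fun x y => hLeib₁ x y b) J (n + 1) hJb m a ha
  rwa [show m + 1 + (n + 1) - 1 = m + (n + 1) by omega]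
end
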